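/- Let c = (c₁,…,c_n), where c₁,…,c_n are positive integers. Then the number of words w ∈ W_c with fast(w) = Id_c is at least the number of words w ∈ W_c with slow(w) = Id_c, and these two numbers are equal if and only if c_i = 1 for all i > 1. -/

import Mathlib

lemma foldr_max_mem {w : List ℕ} (h : w ≠ []) : w.foldr max 0 ∈ w := by
  induction w with
  | nil => exact absurd rfl h
  | cons a l ih =>
    rcases eq_or_ne l [] with rfl | hl
    · simp
    · have hm := ih hl
      simp only [List.foldr_cons]
      rcases max_choice a (l.foldr max 0) with h' | h' <;> rw [h']
      · exact List.mem_cons_self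
      · exact List.mem_cons_of_mem _ hm

lemma headI_mem {α : Type*} [Inhabited α] {l : List α} (h : l ≠ []) : l.headI ∈ l := by
  cases l with
  | nil => exact absurd rfl h
  | cons a t => simp

/-- `blocks n w` is the list of maximal (possibly empty) blocks of `w`
separated by occurrences of the letter `n`; that is, if `n` occurs `k` times
in `w`, then `blocks n w = [A₁, A₂, …, A_{k+1}]` where `w = A₁ n A₂ n ⋯ n A_{k+1}`
and no `Aᵢ` contains the letter `n`. -/
def blocks (n : ℕ) : List ℕ → List (List ℕ)
  | [] => [[]]
  | a :: l =>
    if a = n then [] :: blocks n l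
    else (a :: (blocks n l).headI) :: (blocks n l).tail

lemma blocks_ne_nil (n : ℕ) (w : List ℕ) : blocks n w ≠ [] := by
  cases w with
  | nil => simp [blocks]
  | cons a l =>
    simp only [blocks]
    split <;> simp

lemma blocks_length {n : ℕ} {w : List ℕ} : ∀ {A : List ℕ}, A ∈ blocks n w →
    A.length + w.count n ≤ w.length := by
  induction w with
  | nil =>
    intro A hA
    simp only [blocks, List.mem_singleton] at hA
    subst hA; simp
  | cons a l ih =>
    intro A hA
    by_cases h : a = n
    · subst h
      simp only [blocks, if_pos rfl] at hA
      have hcc : (a :: l).count a = l.count a + 1 := by simp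
      cases hA with
      | head =>
        have := List.count_le_length (a := a) (l := l)
        simp only [List.length_nil, List.length_cons, hcc]
        omega
      | tail _ h1 =>
        have := ih h1
        simp only [List.length_cons, hcc]
        omega
    · simp only [blocks, if_neg h] at hA
      have hcc : (a :: l).count n = l.count n := by
        simp [List.count_cons, h]
      cases hA with
      | head =>
        have := ih (headI_mem (blocks_ne_nil n l))
        simp only [List.length_cons, hcc]
        omega
      | tail _ h1 =>
        have := ih (List.mem_of_mem_tail h1)
        simp only [List.length_cons, hcc]
        omega

/-- The generalized stack-sorting map `fast` (the convention in which a letter may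
sit on top of a copy of itself in the stack): `fast ε = ε`, and if
`w = A₁ n A₂ n ⋯ n A_{k+1}` where `n` is the largest letter of `w` (occurring
`k` times) and the `Aᵢ` contain only letters smaller than `n`, then
`fast w = fast A₁ ++ fast A₂ ++ ⋯ ++ fast A_{k+1} ++ n ⋯ n` (with `k` copies of `n`). -/
def fast (w : List ℕ) : List ℕ :=
  if h : w = [] then []
  else
    ((blocks (w.foldr max 0) w).attach.map
      fun (A : {x // x ∈ blocks (w.foldr max 0) w}) =>
      have : A.1.length < w.length := by
        have h1 := blocks_length A.2
        have h2 : 0 < w.count (w.foldr max 0) :=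
          List.count_pos_iff.mpr (foldr_max_mem h)
        omega
      fast A.1).flatten ++ List.replicate (w.count (w.foldr max 0)) (w.foldr max 0)
termination_by w.length

/-- The generalized stack-sorting map `slow` (the convention in which a letter may
not sit on top of a copy of itself in the stack): `slow ε = ε`, and if
`w = A₁ n A₂ n ⋯ n A_{k+1}` where `n` is the largest letter of `w` (occurring
`k` times) and the `Aᵢ` contain only letters smaller than `n`, then
`slow w = slow A₁ ++ slow A₂ ++ [n] ++ slow A₃ ++ [n] ++ ⋯ ++ slow A_{k+1} ++ [n]`. -/
def slow (w : List ℕ) : List ℕ :=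
  if h : w = [] then []
  else
    (have : (blocks (w.foldr max 0) w).headI.length < w.length := by
      have h1 := blocks_length (headI_mem (blocks_ne_nil (w.foldr max 0) w))
      have h2 : 0 < w.count (w.foldr max 0) :=
        List.count_pos_iff.mpr (foldr_max_mem h)
      omega
     slow (blocks (w.foldr max 0) w).headI) ++
    ((blocks (w.foldr max 0) w).tail.attach.map
      fun (A : {x // x ∈ (blocks (w.foldr max 0) w).tail}) =>
      have : A.1.length < w.length := by
        have h1 := blocks_length (List.mem_of_mem_tail A.2)
        have h2 : 0 < w.count (w.foldr max 0) :=
          List.count_pos_iff.mpr (foldr_max_mem h)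
        omega
      slow A.1 ++ [w.foldr max 0]).flatten
termination_by w.length

/-- Membership in `W_c`: `w` is a word over the positive integers with exactly
`cᵢ` copies of the letter `i` for each `1 ≤ i ≤ n = c.length` (and no other letters). -/
def InW (c : List ℕ) (w : List ℕ) : Prop :=
  0 ∉ w ∧ ∀ i : ℕ, w.count (i + 1) = c.getD i 0

/-- The identity word `Id_c = 1^{c₁} 2^{c₂} ⋯ n^{c_n}`, the unique word in `W_c`
whose letters are nondecreasing from left to right. -/
def idWord (c : List ℕ) : List ℕ :=
  ((List.range c.length).map fun i => List.replicate (c.getD i 0) (i + 1)).flatten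

lemma fast_nil : fast [] = [] := by rw [fast]; simp

lemma slow_nil : slow [] = [] := by rw [slow]; simp

lemma fast_eq {w : List ℕ} (h : w ≠ []) :
    fast w = ((blocks (w.foldr max 0) w).map fast).flatten ++
      List.replicate (w.count (w.foldr max 0)) (w.foldr max 0) := by
  rw [fast, dif_neg h, List.attach_map_val (f := fast)]

lemma slow_eq {w : List ℕ} (h : w ≠ []) :
    slow w = slow (blocks (w.foldr max 0) w).headI ++
      ((blocks (w.foldr max 0) w).tail.map fun A => slow A ++ [w.foldr max 0]).flatten := by
  rw [slow, dif_neg h,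
    List.attach_map_val (f := fun A => slow A ++ [w.foldr max 0])]

lemma le_foldr_max {w : List ℕ} {x : ℕ} (hx : x ∈ w) : x ≤ w.foldr max 0 := by
  induction w with
  | nil => simp at hx
  | cons a l ih =>
    rcases List.mem_cons.1 hx with rfl | h
    · simp
    · exact (ih h).trans (by simp)

lemma foldr_max_eq {w : List ℕ} {m : ℕ} (hm : m ∈ w) (h : ∀ x ∈ w, x ≤ m) :
    w.foldr max 0 = m :=
  le_antisymm (h _ (foldr_max_mem (List.ne_nil_of_mem hm))) (le_foldr_max hm)

lemma length_lt_of_mem_blocks_foldr_max {w A : List ℕ} (h : w ≠ [])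
    (hA : A ∈ blocks (w.foldr max 0) w) : A.length < w.length := by
  have h1 := blocks_length hA
  have h2 : 0 < w.count (w.foldr max 0) := List.count_pos_iff.mpr (foldr_max_mem h)
  omega

lemma exists_blocks_eq_cons (n : ℕ) (w : List ℕ) : ∃ h t, blocks n w = h :: t :=
  List.exists_cons_of_ne_nil (blocks_ne_nil n w)

lemma length_blocks (n : ℕ) (w : List ℕ) : (blocks n w).length = w.count n + 1 := by
  induction w with
  | nil => simp [blocks]
  | cons a l ih =>
    obtain ⟨h, t, e⟩ := exists_blocks_eq_cons n l
    by_cases ha : a = n <;> simp_all [blocks]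

lemma blocks_of_notMem {n : ℕ} {w : List ℕ} (h : n ∉ w) : blocks n w = [w] := by
  induction w with
  | nil => rfl
  | cons a l ih =>
    simp only [List.mem_cons, not_or] at h
    simp [blocks, ih h.2, Ne.symm h.1]

lemma blocks_replicate (n k : ℕ) :
    blocks n (List.replicate k n) = List.replicate (k + 1) [] := by
  induction k with
  | zero => rfl
  | succ k ih => rw [List.replicate_succ, blocks, if_pos rfl, ih, ← List.replicate_succ]

lemma blocks_append_replicate {n : ℕ} {u : List ℕ} (k : ℕ) (h : n ∉ u) :
    blocks n (u ++ List.replicate k n) = u :: List.replicate k [] := by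
  induction u with
  | nil => simp [blocks_replicate, List.replicate_succ]
  | cons a l ih =>
    simp only [List.mem_cons, not_or] at h
    simp [blocks, ih h.2, Ne.symm h.1]

lemma blocks_replicate_append {n : ℕ} {u : List ℕ} (k : ℕ) (h : n ∉ u) :
    blocks n (List.replicate k n ++ u) = List.replicate k [] ++ [u] := by
  induction k with
  | zero => simpa using blocks_of_notMem h
  | succ k ih => simp [List.replicate_succ, blocks, ih]

lemma flatten_blocks_perm (n : ℕ) (w : List ℕ) :
    ((blocks n w).flatten ++ List.replicate (w.count n) n).Perm w := by
  induction w with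
  | nil => simp [blocks]
  | cons a l ih =>
    obtain ⟨h, t, e⟩ := exists_blocks_eq_cons n l
    by_cases ha : a = n
    · subst ha
      simp only [blocks, if_true, List.flatten_cons, List.nil_append, List.count_cons_self,
        List.replicate_succ]
      exact List.perm_middle.trans (ih.cons a)
    · rw [List.count_cons_of_ne ha]
      simp only [blocks, if_neg ha]
      rw [e] at ih ⊢
      simpa using ih

lemma sublist_of_mem_blocks {n : ℕ} {w A : List ℕ} (hA : A ∈ blocks n w) : A.Sublist w := by
  induction w generalizing A with
  | nil => simp_all [blocks]
  | cons a l ih =>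
    obtain ⟨h, t, e⟩ := exists_blocks_eq_cons n l
    rw [e] at ih
    by_cases ha : a = n
    · simp only [blocks, if_pos ha, e, List.mem_cons] at hA
      rcases hA with rfl | hA
      · simp
      · exact (ih (List.mem_cons.2 hA)).cons a
    · simp only [blocks, if_neg ha, e, List.headI_cons, List.tail_cons, List.mem_cons] at hA
      rcases hA with rfl | hA
      · exact (ih List.mem_cons_self).cons_cons a
      · exact (ih (List.mem_cons_of_mem _ hA)).cons a

lemma flatten_map_perm {f : List ℕ → List ℕ} {L : List (List ℕ)}
    (h : ∀ A ∈ L, (f A).Perm A) : (L.map f).flatten.Perm L.flatten := by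
  induction L with
  | nil => simp
  | cons a l ih =>
    simp only [List.map_cons, List.flatten_cons]
    exact (h a List.mem_cons_self).append (ih fun A hA => h A (List.mem_cons_of_mem _ hA))

lemma fast_perm (w : List ℕ) : (fast w).Perm w := by
  rcases eq_or_ne w [] with rfl | h
  · simp [fast_nil]
  · rw [fast_eq h]
    refine ((flatten_map_perm fun A hA => ?_).append_right _).trans (flatten_blocks_perm _ w)
    have := length_lt_of_mem_blocks_foldr_max h hA
    exact fast_perm A
termination_by w.length

lemma flatten_map_append_singleton_perm (f : List ℕ → List ℕ) (L : List (List ℕ)) (n : ℕ) :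
    (L.map fun A => f A ++ [n]).flatten.Perm
      ((L.map f).flatten ++ List.replicate L.length n) := by
  induction L with
  | nil => simp
  | cons a l ih =>
    simp only [List.map_cons, List.flatten_cons, List.length_cons, List.replicate_succ,
      List.append_assoc, List.singleton_append]
    exact ((ih.cons n).trans List.perm_middle.symm).append_left _

lemma flatten_map_sublist (f : List ℕ → List ℕ) (L : List (List ℕ)) (n : ℕ) :
    (L.map f).flatten.Sublist (L.map fun A => f A ++ [n]).flatten := by
  induction L with
  | nil => simp
  | cons a l ih =>
    simp only [List.map_cons, List.flatten_cons]
    exact (List.sublist_append_left _ _).append ih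

lemma slow_perm (w : List ℕ) : (slow w).Perm w := by
  rcases eq_or_ne w [] with rfl | h
  · simp [slow_nil]
  · have ih : ∀ A ∈ blocks (w.foldr max 0) w, (slow A).Perm A := fun A hA => by
      have := length_lt_of_mem_blocks_foldr_max h hA
      exact slow_perm A
    refine List.Perm.trans ?_ (flatten_blocks_perm (w.foldr max 0) w)
    rw [slow_eq h]
    have hl := length_blocks (w.foldr max 0) w
    obtain ⟨a, t, e⟩ := exists_blocks_eq_cons (w.foldr max 0) w
    rw [e] at ih hl ⊢
    simp only [List.length_cons, Nat.add_right_cancel_iff] at hl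
    simp only [List.headI_cons, List.tail_cons, List.flatten_cons, List.append_assoc, ← hl]
    exact (ih a List.mem_cons_self).append
      ((flatten_map_append_singleton_perm slow t _).trans
        ((flatten_map_perm fun A hA => ih A (List.mem_cons_of_mem _ hA)).append_right _))
termination_by w.length

lemma fast_pairwise_of_slow_pairwise (w : List ℕ) (hs : (slow w).Pairwise (· ≤ ·)) :
    (fast w).Pairwise (· ≤ ·) := by
  rcases eq_or_ne w [] with rfl | h
  · simp [fast_nil]
  · have hsub : ((blocks (w.foldr max 0) w).map slow).flatten.Sublist (slow w) := by
      rw [slow_eq h]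
      obtain ⟨a, t, e⟩ := exists_blocks_eq_cons (w.foldr max 0) w
      rw [e]
      exact (List.Sublist.refl _).append (flatten_map_sublist slow t _)
    have hb := hs.sublist hsub
    rw [List.pairwise_flatten, List.pairwise_map] at hb
    have hp := fast_perm w
    rw [fast_eq h] at hp ⊢
    refine List.pairwise_append.2 ⟨?_, List.pairwise_replicate.2 (Or.inr le_rfl), ?_⟩
    · rw [List.pairwise_flatten, List.pairwise_map]
      refine ⟨fun l hl => ?_, hb.2.imp fun {A B} hAB x hx y hy => ?_⟩
      · obtain ⟨A, hA, rfl⟩ := List.mem_map.1 hl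
        have := length_lt_of_mem_blocks_foldr_max h hA
        exact fast_pairwise_of_slow_pairwise A (hb.1 _ (List.mem_map_of_mem hA))
      · exact hAB x ((slow_perm A).mem_iff.2 ((fast_perm A).mem_iff.1 hx))
          y ((slow_perm B).mem_iff.2 ((fast_perm B).mem_iff.1 hy))
    · intro x hx y hy
      rw [List.eq_of_mem_replicate hy]
      exact le_foldr_max (hp.mem_iff.1 (List.mem_append_left _ hx))
termination_by w.length

lemma slow_eq_fast (w : List ℕ) (h0 : 0 ∉ w) (h1 : ∀ i, 2 ≤ i → w.count i ≤ 1) :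
    slow w = fast w := by
  rcases eq_or_ne w [] with rfl | h
  · simp [fast_nil, slow_nil]
  · have ih : ∀ A ∈ blocks (w.foldr max 0) w, slow A = fast A := fun A hA => by
      have := length_lt_of_mem_blocks_foldr_max h hA
      have hs := sublist_of_mem_blocks hA
      exact slow_eq_fast A (fun h => h0 (hs.subset h))
        fun i hi => (hs.count_le i).trans (h1 i hi)
    rcases lt_or_ge (w.foldr max 0) 2 with hm | hm
    · have hw : w = List.replicate w.length 1 := by
        refine List.eq_replicate_iff.2 ⟨rfl, fun b hb => ?_⟩
        have := le_foldr_max hb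
        have : b ≠ 0 := fun e => h0 (e ▸ hb)
        omega
      have e1 := slow_perm w
      have e2 := fast_perm w
      rw [hw] at e1 e2
      rw [hw, List.perm_replicate.1 e1, List.perm_replicate.1 e2]
    · have hc : w.count (w.foldr max 0) = 1 :=
        le_antisymm (h1 _ hm) (List.count_pos_iff.2 (foldr_max_mem h))
      have hl := length_blocks (w.foldr max 0) w
      rw [hc] at hl
      obtain ⟨A, B, e⟩ := List.length_eq_two.1 hl
      rw [slow_eq h, fast_eq h, hc, e]
      rw [e] at ih
      simp [ih A, ih B]
termination_by w.length

lemma fast_append_replicate {u : List ℕ} {n : ℕ} (k : ℕ) (h : ∀ x ∈ u, x < n) :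
    fast (u ++ List.replicate k n) = fast u ++ List.replicate k n := by
  rcases Nat.eq_zero_or_pos k with rfl | hk
  · simp
  · have hn : n ∉ u := fun hn => lt_irrefl _ (h n hn)
    have hm : (u ++ List.replicate k n).foldr max 0 = n := by
      refine foldr_max_eq (by simp; omega) fun x hx => ?_
      rcases List.mem_append.1 hx with hx | hx
      · exact (h x hx).le
      · exact (List.eq_of_mem_replicate hx).le
    rw [fast_eq (by simp; omega), hm, blocks_append_replicate k hn]
    simp [fast_nil, List.count_eq_zero_of_not_mem hn]

lemma slow_append_replicate {u : List ℕ} {n : ℕ} (k : ℕ) (h : ∀ x ∈ u, x < n) :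
    slow (u ++ List.replicate k n) = slow u ++ List.replicate k n := by
  rcases Nat.eq_zero_or_pos k with rfl | hk
  · simp
  · have hn : n ∉ u := fun hn => lt_irrefl _ (h n hn)
    have hm : (u ++ List.replicate k n).foldr max 0 = n := by
      refine foldr_max_eq (by simp; omega) fun x hx => ?_
      rcases List.mem_append.1 hx with hx | hx
      · exact (h x hx).le
      · exact (List.eq_of_mem_replicate hx).le
    rw [slow_eq (by simp; omega), hm, blocks_append_replicate k hn]
    simp [slow_nil]

lemma fast_replicate_append {u : List ℕ} {n k : ℕ} (hk : 0 < k) (h : ∀ x ∈ u, x < n) :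
    fast (List.replicate k n ++ u) = fast u ++ List.replicate k n := by
  have hn : n ∉ u := fun hn => lt_irrefl _ (h n hn)
  have hm : (List.replicate k n ++ u).foldr max 0 = n := by
    refine foldr_max_eq (by simp; omega) fun x hx => ?_
    rcases List.mem_append.1 hx with hx | hx
    · exact (List.eq_of_mem_replicate hx).le
    · exact (h x hx).le
  rw [fast_eq (by simp; omega), hm, blocks_replicate_append k hn]
  simp [fast_nil, List.count_eq_zero_of_not_mem hn]

lemma slow_replicate_append {u : List ℕ} {n : ℕ} (k : ℕ) (h : ∀ x ∈ u, x < n) :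
    slow (List.replicate (k + 1) n ++ u) = List.replicate k n ++ (slow u ++ [n]) := by
  have hn : n ∉ u := fun hn => lt_irrefl _ (h n hn)
  have hm : (List.replicate (k + 1) n ++ u).foldr max 0 = n := by
    refine foldr_max_eq (by simp) fun x hx => ?_
    rcases List.mem_append.1 hx with hx | hx
    · exact (List.eq_of_mem_replicate hx).le
    · exact (h x hx).le
  rw [slow_eq (by simp), hm, blocks_replicate_append (k + 1) hn]
  simp [slow_nil, List.replicate_succ]

lemma idWord_append_singleton (c : List ℕ) (k : ℕ) :
    idWord (c ++ [k]) = idWord c ++ List.replicate k (c.length + 1) := by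
  simp only [idWord, List.length_append, List.length_singleton, List.range_succ, List.map_append,
    List.flatten_append, List.map_singleton, List.flatten_singleton]
  congr 2
  · refine List.map_congr_left fun i hi => ?_
    rw [List.getD_append _ _ _ _ (List.mem_range.1 hi)]
  · simp

lemma mem_idWord {c : List ℕ} {x : ℕ} (hx : x ∈ idWord c) : 0 < x ∧ x < c.length + 1 := by
  simp only [idWord, List.mem_flatten, List.mem_map, List.mem_range] at hx
  obtain ⟨_, ⟨i, hi, rfl⟩, hx⟩ := hx
  rw [List.eq_of_mem_replicate hx]
  omega

lemma pairwise_append_replicate {u : List ℕ} {n : ℕ} (k : ℕ) (hu : u.Pairwise (· ≤ ·))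
    (h : ∀ x ∈ u, x < n) : (u ++ List.replicate k n).Pairwise (· ≤ ·) := by
  refine List.pairwise_append.2 ⟨hu, List.pairwise_replicate.2 (Or.inr le_rfl), ?_⟩
  intro x hx y hy
  rw [List.eq_of_mem_replicate hy]
  exact (h x hx).le

lemma idWord_pairwise (c : List ℕ) : (idWord c).Pairwise (· ≤ ·) := by
  induction c using List.reverseRecOn with
  | nil => simp [idWord]
  | append_singleton c k ih =>
    rw [idWord_append_singleton]
    exact pairwise_append_replicate k ih fun x hx => (mem_idWord hx).2

lemma fast_idWord (c : List ℕ) : fast (idWord c) = idWord c := by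
  induction c using List.reverseRecOn with
  | nil => simp [idWord, fast_nil]
  | append_singleton c k ih =>
    rw [idWord_append_singleton, fast_append_replicate k fun x hx => (mem_idWord hx).2, ih]

lemma count_idWord (c : List ℕ) (i : ℕ) : (idWord c).count (i + 1) = c.getD i 0 := by
  induction c using List.reverseRecOn with
  | nil => simp [idWord]
  | append_singleton c k ih =>
    rw [idWord_append_singleton, List.count_append, ih, List.count_replicate]
    rcases lt_trichotomy i c.length with h | rfl | h
    · rw [List.getD_append _ _ _ _ h]
      simp [h.ne']
    · simp
    · rw [List.getD_eq_default _ _ h.le, List.getD_eq_default _ _ (by simp; omega)]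
      simp [h.ne]

lemma inW_iff_perm {c w : List ℕ} : InW c w ↔ w.Perm (idWord c) := by
  have h0 : 0 ∉ idWord c := fun h => lt_irrefl _ (mem_idWord h).1
  constructor
  · rintro ⟨hw, h⟩
    refine List.perm_iff_count.2 fun a => ?_
    rcases a with _ | a
    · rw [List.count_eq_zero_of_not_mem hw, List.count_eq_zero_of_not_mem h0]
    · rw [h, count_idWord]
  · intro h
    exact ⟨fun hw => h0 (h.mem_iff.1 hw), fun i => by rw [h.count_eq, count_idWord]⟩

lemma eq_idWord_iff_pairwise {c u : List ℕ} (h : u.Perm (idWord c)) :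
    u = idWord c ↔ u.Pairwise (· ≤ ·) :=
  ⟨fun e => e ▸ idWord_pairwise c, fun hu => h.eq_of_pairwise' hu (idWord_pairwise c)⟩

lemma exists_fast_sortable_not_slow_sortable {c : List ℕ} (hc : ∀ x ∈ c, 0 < x) {i : ℕ}
    (hi : 1 ≤ i) (hic : i < c.length) (h2 : 2 ≤ c.getD i 0) :
    ∃ w : List ℕ, w.Perm (idWord c) ∧ (fast w).Pairwise (· ≤ ·) ∧
      ¬ (slow w).Pairwise (· ≤ ·) := by
  induction c using List.reverseRecOn with
  | nil => simp at hic
  | append_singleton c k ih =>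
    rw [idWord_append_singleton]
    simp only [List.length_append, List.length_singleton] at hic
    rcases Nat.lt_succ_iff_lt_or_eq.1 hic with h | rfl
    · rw [List.getD_append _ _ _ _ h] at h2
      obtain ⟨w, hw, hf, hs⟩ := ih (fun x hx => hc x (List.mem_append_left _ hx)) h h2
      have hlt : ∀ x ∈ w, x < c.length + 1 := fun x hx => (mem_idWord (hw.mem_iff.1 hx)).2
      refine ⟨w ++ List.replicate k (c.length + 1), hw.append_right _, ?_, ?_⟩
      · rw [fast_append_replicate k hlt]
        exact pairwise_append_replicate k hf fun x hx => hlt x ((fast_perm w).mem_iff.1 hx)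
      · rw [slow_append_replicate k hlt]
        exact fun h => hs (List.pairwise_append.1 h).1
    · have hk : 2 ≤ k := by simpa using h2
      have hlt : ∀ x ∈ idWord c, x < c.length + 1 := fun x hx => (mem_idWord hx).2
      refine ⟨List.replicate k (c.length + 1) ++ idWord c, List.perm_append_comm, ?_, ?_⟩
      · rw [fast_replicate_append (by omega) hlt, fast_idWord]
        exact pairwise_append_replicate k (idWord_pairwise c) hlt
      · obtain ⟨k, rfl⟩ := Nat.exists_eq_add_of_le' hk
        rw [slow_replicate_append (k + 1) hlt]
        have h1 : 1 ∈ idWord c := by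
          rw [← List.count_pos_iff, count_idWord c 0, List.getD_eq_getElem _ _ hi]
          exact hc _ (List.mem_append_left _ (List.getElem_mem _))
        intro h
        have := (List.pairwise_append.1 h).2.2 (c.length + 1) (by simp) 1
          (List.mem_append_left _ ((slow_perm _).mem_iff.2 h1))
        omega

/-- For any `c = (c₁, …, c_n)` with `c₁, …, c_n` positive, the number of `fast`-sortable
words in `W_c` is at least the number of `slow`-sortable words in `W_c`, with equality
exactly when `cᵢ = 1` for all `i > 1`. -/
theorem fast_sortable_ge_slow_sortable (c : List ℕ) (hc : ∀ x ∈ c, 0 < x) :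
    {w : List ℕ | InW c w ∧ fast w = idWord c}.Finite ∧
    {w : List ℕ | InW c w ∧ slow w = idWord c}.Finite ∧
    {w : List ℕ | InW c w ∧ slow w = idWord c}.ncard ≤
      {w : List ℕ | InW c w ∧ fast w = idWord c}.ncard ∧
    ({w : List ℕ | InW c w ∧ fast w = idWord c}.ncard =
        {w : List ℕ | InW c w ∧ slow w = idWord c}.ncard ↔
      ∀ i : ℕ, 1 ≤ i → i < c.length → c.getD i 0 = 1) := by
  have hfin : {w : List ℕ | InW c w}.Finite :=
    (idWord c).permutations.finite_toSet.subset fun w hw =>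
      List.mem_permutations.2 (inW_iff_perm.1 hw)
  have hF : {w : List ℕ | InW c w ∧ fast w = idWord c}.Finite := hfin.subset fun w hw => hw.1
  have hS : {w : List ℕ | InW c w ∧ slow w = idWord c}.Finite := hfin.subset fun w hw => hw.1
  have hfast : ∀ w, InW c w → (fast w = idWord c ↔ (fast w).Pairwise (· ≤ ·)) := fun w hw =>
    eq_idWord_iff_pairwise ((fast_perm w).trans (inW_iff_perm.1 hw))
  have hslow : ∀ w, InW c w → (slow w = idWord c ↔ (slow w).Pairwise (· ≤ ·)) := fun w hw =>
    eq_idWord_iff_pairwise ((slow_perm w).trans (inW_iff_perm.1 hw))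
  have hsub : {w : List ℕ | InW c w ∧ slow w = idWord c} ⊆
      {w : List ℕ | InW c w ∧ fast w = idWord c} := fun w hw =>
    ⟨hw.1, (hfast w hw.1).2 (fast_pairwise_of_slow_pairwise w ((hslow w hw.1).1 hw.2))⟩
  refine ⟨hF, hS, Set.ncard_le_ncard hsub hF, fun heq i hi hic => ?_, fun h => ?_⟩
  · have hset := Set.eq_of_subset_of_ncard_le hsub heq.le hF
    have hpos : 0 < c.getD i 0 := by
      rw [List.getD_eq_getElem _ _ hic]
      exact hc _ (List.getElem_mem _)
    by_contra hne
    obtain ⟨w, hw, hf, hs⟩ := exists_fast_sortable_not_slow_sortable hc hi hic (by omega)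
    have hW := inW_iff_perm.2 hw
    have hmem : w ∈ {w : List ℕ | InW c w ∧ slow w = idWord c} :=
      hset ▸ ⟨hW, (hfast w hW).2 hf⟩
    exact hs ((hslow w hW).1 hmem.2)
  · congr 1
    ext w
    refine and_congr_right fun hw => ?_
    rw [slow_eq_fast w hw.1 fun i hi => ?_]
    obtain ⟨j, rfl⟩ := Nat.exists_eq_add_of_le' hi
    rw [hw.2 (j + 1)]
    rcases lt_or_ge (j + 1) c.length with hj | hj
    · exact (h _ (by omega) hj).le
    · rw [List.getD_eq_default _ _ hj]
      omega
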